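/- For every θ ∈ Θ and every α ∈ (0,1), the plausibility region has at least the nominal frequentist coverage probability: P_θ({y : θ ∈ Π_y(α)}) ≥ 1 − α. (Corollary 2, coverage bound.) -/

import Mathlib

open MeasureTheory

theorem measurableSet_setOf_measure_Iic_le (μ : Measure ℝ) (a : ENNReal) :
    MeasurableSet {t | μ (Set.Iic t) ≤ a} := by
  have hmono : Monotone fun t => μ (Set.Iic t) :=
    fun _ _ h => measure_mono (Set.Iic_subset_Iic.2 h)
  exact measurableSet_le hmono.measurable measurable_const

/-- A finite measure on `ℝ` gives mass at most `a` to the set where its distribution function is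
at most `a`. -/
theorem measure_setOf_measure_Iic_le (μ : Measure ℝ) [IsFiniteMeasure μ] (a : ENNReal) :
    μ {t | μ (Set.Iic t) ≤ a} ≤ a := by
  rw [(measurableSet_setOf_measure_Iic_le μ a).measure_eq_iSup_isCompact]
  refine iSup₂_le fun K hK => iSup_le fun hKc => ?_
  rcases K.eq_empty_or_nonempty with rfl | hne
  · simp
  · obtain ⟨t, htK, ht⟩ := hKc.exists_isGreatest hne
    exact (measure_mono ht).trans (hK htK)

/-- Corollary 2 (coverage bound): for every `θ ∈ Θ` and `α ∈ (0,1)`, the plausibility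
region `Pl_y(α) = {θ : pl_y(θ) > α}` has coverage probability at least `1 - α`. -/
theorem plausibility_region_coverage
    {Y : Type*} [MeasurableSpace Y] {Θ : Type*}
    (P : Θ → Measure Y) (hP : ∀ θ, IsProbabilityMeasure (P θ))
    (T : Y → Θ → ℝ) (hT : ∀ θ, Measurable fun y => T y θ)
    (F : Θ → ℝ → ℝ) (hF : ∀ θ t, F θ t = (P θ {y | T y θ ≤ t}).toReal)
    (Pl : Y → ℝ → Set Θ) (hPl : ∀ y a, Pl y a = {θ | a < F θ (T y θ)})
    (θ : Θ) (α : ℝ) (hα : α ∈ Set.Ioo (0 : ℝ) 1) :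
    ENNReal.ofReal (1 - α) ≤ P θ {y | θ ∈ Pl y α} := by
  have := hP θ
  set μ := (P θ).map fun y => T y θ with hμ
  have hIic (t : ℝ) : μ (Set.Iic t) = P θ {y | T y θ ≤ t} :=
    Measure.map_apply (hT θ) measurableSet_Iic
  have hμp : IsProbabilityMeasure μ := Measure.isProbabilityMeasure_map (hT θ).aemeasurable
  have hS := measurableSet_setOf_measure_Iic_le μ (ENNReal.ofReal α)
  have hcompl : {y | θ ∈ Pl y α} =
      (fun y => T y θ) ⁻¹' {t | μ (Set.Iic t) ≤ ENNReal.ofReal α}ᶜ := by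
    ext y
    simp only [hPl, hF, ← hIic, Set.mem_ofPred_eq, Set.mem_preimage, Set.mem_compl_iff, not_le]
    exact (ENNReal.ofReal_lt_iff_lt_toReal hα.1.le (measure_ne_top _ _)).symm
  rw [hcompl, ← Measure.map_apply (hT θ) hS.compl, ← hμ, prob_compl_eq_one_sub hS,
    ENNReal.ofReal_sub _ hα.1.le, ENNReal.ofReal_one]
  exact tsub_le_tsub_left (measure_setOf_measure_Iic_le μ _) 1
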